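/- Let f : ℝ → ℝ, let a : ℝ and r > 0, and suppose f is defined on the interval (a, a+r). Then f has a (finite) right-hand limit at a (i.e., there exists L : ℝ such that f(x) tends to L as x tends to a from the right within (a, a+r)) if and only if for every σ > 0 there exists ε with 0 < ε < r such that for all δ with 0 < δ < ε, one has |f(a+ε) − f(a+δ)| < σ. -/

import Mathlib

open Filter

theorem dini_right_limit_criterion (f : ℝ → ℝ) (a r : ℝ) (hr : 0 < r) :
    (∃ L : ℝ, Tendsto f (nhdsWithin a (Set.Ioo a (a + r))) (nhds L)) ↔
      ∀ σ > 0, ∃ ε : ℝ, 0 < ε ∧ ε < r ∧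
        ∀ δ : ℝ, 0 < δ → δ < ε → |f (a + ε) - f (a + δ)| < σ := by
  have hnhds : nhdsWithin a (Set.Ioo a (a + r)) = nhdsWithin a (Set.Ioi a) :=
    nhdsWithin_Ioo_eq_nhdsGT (by linarith)
  rw [hnhds]
  constructor
  · rintro ⟨L, hL⟩ σ hσ
    have hclose := hL.eventually (Metric.ball_mem_nhds L (half_pos hσ))
    obtain ⟨u, hu, hball⟩ := mem_nhdsGT_iff_exists_Ioo_subset.1 hclose
    have hu' : 0 < u - a := sub_pos.2 hu
    obtain ⟨ε, hε, hεlt⟩ := exists_between (lt_min hr hu')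
    obtain ⟨hεr, hεu⟩ := lt_min_iff.1 hεlt
    refine ⟨ε, hε, hεr, fun δ hδ hδε => ?_⟩
    have hfε : dist (f (a + ε)) L < σ / 2 := hball ⟨by linarith, by linarith⟩
    have hfδ : dist (f (a + δ)) L < σ / 2 := hball ⟨by linarith, by linarith⟩
    rw [← Real.dist_eq]
    linarith [dist_triangle_right (f (a + ε)) (f (a + δ)) L]
  · intro h
    rw [← cauchy_map_iff_exists_tendsto, Metric.cauchy_iff]
    refine ⟨inferInstance, fun σ hσ => ?_⟩
    obtain ⟨ε, hε, -, hf⟩ := h (σ / 2) (half_pos hσ)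
    refine ⟨f '' Set.Ioo a (a + ε), image_mem_map (Ioo_mem_nhdsGT (by linarith)), ?_⟩
    rintro _ ⟨x, hx, rfl⟩ _ ⟨y, hy, rfl⟩
    have hfar (z : ℝ) (hz : z ∈ Set.Ioo a (a + ε)) : dist (f (a + ε)) (f z) < σ / 2 := by
      have hdist := hf (z - a) (by linarith [hz.1]) (by linarith [hz.2])
      rwa [add_sub_cancel, ← Real.dist_eq] at hdist
    linarith [dist_triangle_left (f x) (f y) (f (a + ε)), hfar x hx, hfar y hy]
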